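/- arXiv:1103.1085 — 7 statements merged into one kernel-verified Lean document; each statement's English description precedes it below -/
import Mathlib

section
/- Let λ, μ ∈ ℂ with λ ≠ μ. In ℂ³ with standard basis e_1, e_2, e_3, write e_123 = e_1 + e_2 + e_3, and consider the subspaces V_1 = span{e_123}, V_2(ν) = span{e_123, e_1 + ν e_3}, V_3 = span{e_1}, V_4 = span{e_1, e_2}, V_5 = span{e_3}, V_6 = span{e_2, e_3}. Then there is no invertible linear map g : ℂ³ → ℂ³ such that g(V_1) = V_1, g(V_2(λ)) = V_2(μ), g(V_3) = V_3, g(V_4) = V_4, g(V_5) = V_5 and g(V_6) = V_6. -/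
/-- The `i`-th standard basis vector of `ℂⁿ`. -/
noncomputable def e {n : ℕ} (i : Fin n) : Fin n → ℂ := Pi.single i 1

theorem apply_mem_of_map_span_eq {R M N : Type*} [Semiring R] [AddCommMonoid M]
    [AddCommMonoid N] [Module R M] [Module R N] {f : M →ₗ[R] N} {s : Set M} {q : Submodule R N}
    (hf : (Submodule.span R s).map f = q) {x : M} (hx : x ∈ s) : f x ∈ q :=
  hf ▸ Submodule.mem_map_of_mem (Submodule.subset_span hx)

/-- A linear endomorphism of `ℂ³` preserving `⟨e₁₂₃⟩`, `⟨e₁⟩`, `⟨e₁,e₂⟩`, `⟨e₃⟩` and `⟨e₂,e₃⟩`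
scales `e₁` and `e₃` by the same factor. -/
theorem exists_smul_of_mem_span (f : (Fin 3 → ℂ) →ₗ[ℂ] (Fin 3 → ℂ))
    (hsum : f (e 0 + e 1 + e 2) ∈ Submodule.span ℂ {e 0 + e 1 + e 2})
    (h0 : f (e 0) ∈ Submodule.span ℂ {e 0})
    (h01 : f (e 1) ∈ Submodule.span ℂ {e 0, e 1})
    (h2 : f (e 2) ∈ Submodule.span ℂ {e 2})
    (h12 : f (e 1) ∈ Submodule.span ℂ {e 1, e 2}) :
    ∃ t : ℂ, f (e 0) = t • e 0 ∧ f (e 2) = t • e 2 := by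
  obtain ⟨t, ht⟩ := Submodule.mem_span_singleton.1 hsum
  obtain ⟨a, ha⟩ := Submodule.mem_span_singleton.1 h0
  obtain ⟨c, hc⟩ := Submodule.mem_span_singleton.1 h2
  obtain ⟨p, q, hpq⟩ := Submodule.mem_span_pair.1 h01
  obtain ⟨r, s, hrs⟩ := Submodule.mem_span_pair.1 h12
  have f1_zero : f (e 1) 0 = 0 := by rw [← hrs]; simp [e]
  have f1_two : f (e 1) 2 = 0 := by rw [← hpq]; simp [e]
  rw [map_add, map_add, ← ha, ← hc] at ht
  generalize f (e 1) = v at ht f1_zero f1_two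
  have hta : t = a := by simpa [e, f1_zero] using congrFun ht 0
  have htc : t = c := by simpa [e, f1_two] using congrFun ht 2
  exact ⟨t, by rw [← ha, hta], by rw [← hc, htc]⟩

/-- **Nonequivalence of the representations `𝒱_λ((2,2,2))`.**
With `e₁₂₃ = e₁ + e₂ + e₃`, for `λ ≠ μ` there is no invertible linear map
`g : ℂ³ → ℂ³` fixing `⟨e₁₂₃⟩`, `⟨e₁⟩`, `⟨e₁,e₂⟩`, `⟨e₃⟩`, `⟨e₂,e₃⟩` and
sending `⟨e₁₂₃, e₁+λe₃⟩` to `⟨e₁₂₃, e₁+μe₃⟩`. -/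
theorem nonequiv_222 (lam mu : ℂ) (h : lam ≠ mu) :
    ¬ ∃ g : (Fin 3 → ℂ) ≃ₗ[ℂ] (Fin 3 → ℂ),
      (Submodule.span ℂ {e 0 + e 1 + e 2}).map g.toLinearMap =
        Submodule.span ℂ {e 0 + e 1 + e 2} ∧
      (Submodule.span ℂ {e 0 + e 1 + e 2, e 0 + lam • e 2}).map g.toLinearMap =
        Submodule.span ℂ {e 0 + e 1 + e 2, e 0 + mu • e 2} ∧
      (Submodule.span ℂ {e 0}).map g.toLinearMap = Submodule.span ℂ {e 0} ∧
      (Submodule.span ℂ {e 0, e 1}).map g.toLinearMap = Submodule.span ℂ {e 0, e 1} ∧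
      (Submodule.span ℂ {e 2}).map g.toLinearMap = Submodule.span ℂ {e 2} ∧
      (Submodule.span ℂ {e 1, e 2}).map g.toLinearMap = Submodule.span ℂ {e 1, e 2} := by
  rintro ⟨g, hsum, hpair, h0, h01, h2, h12⟩
  obtain ⟨t, ht0, ht2⟩ := exists_smul_of_mem_span g.toLinearMap
    (apply_mem_of_map_span_eq hsum (by simp)) (apply_mem_of_map_span_eq h0 (by simp))
    (apply_mem_of_map_span_eq h01 (by simp)) (apply_mem_of_map_span_eq h2 (by simp))
    (apply_mem_of_map_span_eq h12 (by simp))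
  have ht : t ≠ 0 := by
    rintro rfl
    have he : (e 0 : Fin 3 → ℂ) = 0 := g.map_eq_zero_iff.1 (by simpa using ht0)
    simpa [e] using congrFun he 0
  obtain ⟨x, y, hxy⟩ := Submodule.mem_span_pair.1
    (apply_mem_of_map_span_eq hpair (x := e 0 + lam • e 2) (by simp))
  rw [map_add, map_smul, ht0, ht2] at hxy
  have hx : x = 0 := by simpa [e] using congrFun hxy 1
  have hy : y = t := by simpa [e, hx] using congrFun hxy 0
  have hmu : t * mu = lam * t := by simpa [e, hx, hy] using congrFun hxy 2
  exact h (mul_left_cancel₀ ht (by rw [hmu, mul_comm]))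
end

section
/- Let λ, μ ∈ ℂ with λ ≠ μ. In ℂ⁶ with standard basis e_1,...,e_6, write e_123 = e_1 + e_2 + e_3, e_245 = e_2 + e_4 + e_5, e_16 = e_1 + e_6, and consider the subspaces V_1 = span{e_123, e_245, e_16}, V_2 = span{e_5, e_6}, V_3 = span{e_1, e_2, e_5, e_6}, V_4 = span{e_4}, V_5 = span{e_3, e_4}, V_6 = span{e_2, e_3, e_4}, V_7 = span{e_1, e_2, e_3, e_4}, V_8(ν) = span{e_1, e_2, e_3, e_4, e_5 + ν e_6}. Then there is no invertible linear map g : ℂ⁶ → ℂ⁶ such that g(V_i) = V_i for i ∈ {1,...,7} and g(V_8(λ)) = V_8(μ). -/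
/-- If `g` maps `span S` onto `span T`, a functional vanishing on `T` vanishes on `g '' S`. -/
theorem functional_apply_eq_zero_of_map_span_eq {K V : Type*} [Field K] [AddCommGroup V]
    [Module K V] {g : V →ₗ[K] V} {S T : Set V}
    (h : (Submodule.span K S).map g = Submodule.span K T) (f : V →ₗ[K] K)
    (hf : ∀ t ∈ T, f t = 0) {v : V} (hv : v ∈ S) : f (g v) = 0 := by
  have hT : Submodule.span K T ≤ LinearMap.ker f := Submodule.span_le.2 hf
  exact hT (h ▸ Submodule.mem_map_of_mem (Submodule.subset_span hv))

/-- **Nonequivalence of the representations `𝒱_λ((1,2,5))`.**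
With `e₁₂₃ = e₁+e₂+e₃`, `e₂₄₅ = e₂+e₄+e₅`, `e₁₆ = e₁+e₆` in `ℂ⁶`, for `λ ≠ μ`
there is no invertible linear map `g : ℂ⁶ → ℂ⁶` fixing the subspaces
`⟨e₁₂₃,e₂₄₅,e₁₆⟩`, `⟨e₅,e₆⟩`, `⟨e₁,e₂,e₅,e₆⟩`, `⟨e₄⟩`, `⟨e₃,e₄⟩`, `⟨e₂,e₃,e₄⟩`,
`⟨e₁,e₂,e₃,e₄⟩` and sending `⟨e₁,e₂,e₃,e₄,e₅+λe₆⟩` to `⟨e₁,e₂,e₃,e₄,e₅+μe₆⟩`. -/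
theorem nonequiv_125 (lam mu : ℂ) (h : lam ≠ mu) :
    ¬ ∃ g : (Fin 6 → ℂ) ≃ₗ[ℂ] (Fin 6 → ℂ),
      (Submodule.span ℂ {e 0 + e 1 + e 2, e 1 + e 3 + e 4, e 0 + e 5}).map g.toLinearMap =
        Submodule.span ℂ {e 0 + e 1 + e 2, e 1 + e 3 + e 4, e 0 + e 5} ∧
      (Submodule.span ℂ {e 4, e 5}).map g.toLinearMap = Submodule.span ℂ {e 4, e 5} ∧
      (Submodule.span ℂ {e 0, e 1, e 4, e 5}).map g.toLinearMap =
        Submodule.span ℂ {e 0, e 1, e 4, e 5} ∧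
      (Submodule.span ℂ {e 3}).map g.toLinearMap = Submodule.span ℂ {e 3} ∧
      (Submodule.span ℂ {e 2, e 3}).map g.toLinearMap = Submodule.span ℂ {e 2, e 3} ∧
      (Submodule.span ℂ {e 1, e 2, e 3}).map g.toLinearMap =
        Submodule.span ℂ {e 1, e 2, e 3} ∧
      (Submodule.span ℂ {e 0, e 1, e 2, e 3}).map g.toLinearMap =
        Submodule.span ℂ {e 0, e 1, e 2, e 3} ∧
      (Submodule.span ℂ {e 0, e 1, e 2, e 3, e 4 + lam • e 5}).map g.toLinearMap =
        Submodule.span ℂ {e 0, e 1, e 2, e 3, e 4 + mu • e 5} := by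
  rintro ⟨g, h1, h2, h3, h4, h5, h6, h7, h8⟩
  let p (i : Fin 6) : (Fin 6 → ℂ) →ₗ[ℂ] ℂ := LinearMap.proj i
  have r0 := fun v ↦ functional_apply_eq_zero_of_map_span_eq (v := v) h1 (p 0 - p 2 - p 5)
    (by simp [p, e])
  have r1 := fun v ↦ functional_apply_eq_zero_of_map_span_eq (v := v) h1 (p 1 - p 2 - p 4)
    (by simp [p, e])
  have r3 := fun v ↦ functional_apply_eq_zero_of_map_span_eq (v := v) h1 (p 3 - p 4)
    (by simp [p, e])
  have s0 := fun v ↦ functional_apply_eq_zero_of_map_span_eq (v := v) h2 (p 0) (by simp [p, e])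
  have s1 := fun v ↦ functional_apply_eq_zero_of_map_span_eq (v := v) h2 (p 1) (by simp [p, e])
  have s2 := fun v ↦ functional_apply_eq_zero_of_map_span_eq (v := v) h2 (p 2) (by simp [p, e])
  have s3 := fun v ↦ functional_apply_eq_zero_of_map_span_eq (v := v) h2 (p 3) (by simp [p, e])
  have t2 := fun v ↦ functional_apply_eq_zero_of_map_span_eq (v := v) h3 (p 2) (by simp [p, e])
  have t3 := fun v ↦ functional_apply_eq_zero_of_map_span_eq (v := v) h3 (p 3) (by simp [p, e])
  have u2 := fun v ↦ functional_apply_eq_zero_of_map_span_eq (v := v) h4 (p 2) (by simp [p, e])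
  have w1 := fun v ↦ functional_apply_eq_zero_of_map_span_eq (v := v) h5 (p 1) (by simp [p, e])
  have x0 := fun v ↦ functional_apply_eq_zero_of_map_span_eq (v := v) h6 (p 0) (by simp [p, e])
  have y4 := fun v ↦ functional_apply_eq_zero_of_map_span_eq (v := v) h7 (p 4) (by simp [p, e])
  have y5 := fun v ↦ functional_apply_eq_zero_of_map_span_eq (v := v) h7 (p 5) (by simp [p, e])
  have z := fun v ↦ functional_apply_eq_zero_of_map_span_eq (v := v) h8 (p 5 - mu • p 4)
    (by simp [p, e])
  simp only [Set.mem_insert_iff, Set.mem_singleton_iff, forall_eq_or_imp, forall_eq, p,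
    LinearEquiv.coe_coe, LinearMap.sub_apply, LinearMap.smul_apply, LinearMap.proj_apply,
    map_add, map_smul, Pi.add_apply, Pi.smul_apply, smul_eq_mul] at *
  have h45 : g (e 4) 5 = 0 := by grind
  have h54 : g (e 5) 4 = 0 := by grind
  have h55 : g (e 5) 5 = g (e 4) 4 := by grind
  have h44 : g (e 4) 4 = 0 := by
    have : (lam - mu) * g (e 4) 4 = 0 := by grind
    exact (mul_eq_zero.1 this).resolve_left (sub_ne_zero.2 h)
  have hg : g (e 4) = 0 := by
    ext i
    fin_cases i <;> simp [*]
  have he : (e 4 : Fin 6 → ℂ) = 0 := (map_eq_zero_iff g g.injective).1 hg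
  simpa [e] using congrFun he 4
end

section
/- Let λ, μ ∈ ℂ with λ ≠ μ. In ℂ⁵ with standard basis e_1,...,e_5, write e_235 = e_2 + e_3 + e_5 and e_134 = e_1 + e_3 + e_4, and consider the subspaces V_1 = span{e_235, e_134}, V_2 = span{e_5}, V_3(ν) = span{e_235, e_134, e_5, e_3 + ν e_4}, V_4 = span{e_1, e_2, e_5}, V_5 = span{e_4}, V_6 = span{e_3, e_4}, V_7 = span{e_2, e_3, e_4}, V_8 = span{e_1, e_2, e_3, e_4}. Then there is no invertible linear map g : ℂ⁵ → ℂ⁵ such that g(V_i) = V_i for i ∈ {1,2,4,5,6,7,8} and g(V_3(λ)) = V_3(μ). -/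
/-- **Nonequivalence of the representations `𝒱_λ((N,4))`.**
With `e₂₃₅ = e₂+e₃+e₅` and `e₁₃₄ = e₁+e₃+e₄` in `ℂ⁵`, for `λ ≠ μ` there is no
invertible linear map `g : ℂ⁵ → ℂ⁵` fixing the subspaces `⟨e₂₃₅,e₁₃₄⟩`, `⟨e₅⟩`,
`⟨e₁,e₂,e₅⟩`, `⟨e₄⟩`, `⟨e₃,e₄⟩`, `⟨e₂,e₃,e₄⟩`, `⟨e₁,e₂,e₃,e₄⟩` and sending
`⟨e₂₃₅,e₁₃₄,e₅,e₃+λe₄⟩` to `⟨e₂₃₅,e₁₃₄,e₅,e₃+μe₄⟩`. -/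
theorem nonequiv_N4 (lam mu : ℂ) (h : lam ≠ mu) :
    ¬ ∃ g : (Fin 5 → ℂ) ≃ₗ[ℂ] (Fin 5 → ℂ),
      (Submodule.span ℂ {e 1 + e 2 + e 4, e 0 + e 2 + e 3}).map g.toLinearMap =
        Submodule.span ℂ {e 1 + e 2 + e 4, e 0 + e 2 + e 3} ∧
      (Submodule.span ℂ {e 4}).map g.toLinearMap = Submodule.span ℂ {e 4} ∧
      (Submodule.span ℂ
          {e 1 + e 2 + e 4, e 0 + e 2 + e 3, e 4, e 2 + lam • e 3}).map g.toLinearMap =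
        Submodule.span ℂ {e 1 + e 2 + e 4, e 0 + e 2 + e 3, e 4, e 2 + mu • e 3} ∧
      (Submodule.span ℂ {e 0, e 1, e 4}).map g.toLinearMap =
        Submodule.span ℂ {e 0, e 1, e 4} ∧
      (Submodule.span ℂ {e 3}).map g.toLinearMap = Submodule.span ℂ {e 3} ∧
      (Submodule.span ℂ {e 2, e 3}).map g.toLinearMap = Submodule.span ℂ {e 2, e 3} ∧
      (Submodule.span ℂ {e 1, e 2, e 3}).map g.toLinearMap =
        Submodule.span ℂ {e 1, e 2, e 3} ∧
      (Submodule.span ℂ {e 0, e 1, e 2, e 3}).map g.toLinearMap =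
        Submodule.span ℂ {e 0, e 1, e 2, e 3} := by
  rintro ⟨g, h₁, h₂, h₃, h₄, h₅, h₆, h₇, h₈⟩
  have image_mem {S T : Set (Fin 5 → ℂ)}
      (hST : (Submodule.span ℂ S).map g.toLinearMap = Submodule.span ℂ T)
      {v : Fin 5 → ℂ} (hv : v ∈ S) : g v ∈ Submodule.span ℂ T :=
    hST ▸ Submodule.mem_map_of_mem (Submodule.subset_span hv)
  have g4 := image_mem h₂ (v := e 4) (by simp)
  have g3 := image_mem h₅ (v := e 3) (by simp)
  have g2 := image_mem h₆ (v := e 2) (by simp)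
  have g1 := image_mem h₄ (v := e 1) (by simp)
  have g1' := image_mem h₇ (v := e 1) (by simp)
  have g0 := image_mem h₄ (v := e 0) (by simp)
  have g0' := image_mem h₈ (v := e 0) (by simp)
  have g124 := image_mem h₁ (v := e 1 + e 2 + e 4) (by simp)
  have g023 := image_mem h₁ (v := e 0 + e 2 + e 3) (by simp)
  have glam := image_mem h₃ (v := e 2 + lam • e 3) (by simp)
  have ne0 : g (e 2) ≠ 0 := by
    simp [e]
  simp only [map_add, map_smul] at g124 g023 glam
  generalize g (e 0) = v0 at *
  generalize g (e 1) = v1 at *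
  generalize g (e 2) = v2 at *
  generalize g (e 3) = v3 at *
  generalize g (e 4) = v4 at *
  clear h₁ h₂ h₃ h₄ h₅ h₆ h₇ h₈ image_mem
  simp only [Submodule.mem_span_insert, Submodule.mem_span_singleton, funext_iff,
    Fin.forall_fin_succ, e] at g0 g0' g1 g1' g2 g3 g4 g124 g023 glam
  simp [Pi.single_apply] at g0 g0' g1 g1' g2 g3 g4 g124 g023 glam
  have v0_coord : v0 2 = 0 ∧ v0 3 = 0 ∧ v0 4 = 0 := by grind
  have v1_coord : v1 0 = 0 ∧ v1 2 = 0 ∧ v1 3 = 0 ∧ v1 4 = 0 := by grind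
  have v2_coord : v2 0 = 0 ∧ v2 1 = 0 ∧ v2 4 = 0 := by grind
  clear g0 g0' g1 g1' g2
  have v2_three : v2 3 = 0 := by grind
  have v3_three : v3 3 = v2 2 := by grind
  have v2_two : v2 2 ≠ 0 := by
    contrapose! ne0
    ext i
    fin_cases i <;> simp [v2_coord, v2_three, ne0]
  have lam_mul : lam * v2 2 = mu * v2 2 := by grind
  exact h (mul_right_cancel₀ v2_two lam_mul)
end

section
/- Let λ ∈ ℂ with λ ≠ 0 and λ ≠ 1. In ℂ² with standard basis e_1, e_2, consider the subspaces V_1 = span{e_1}, V_2 = span{e_2}, V_3 = span{e_1 + e_2}, V_4 = span{e_1 + λ e_2}. Then this system is stable with respect to the weight (1/2, 1/2, 1/2, 1/2): (1/2)(dim V_1 + dim V_2 + dim V_3 + dim V_4) = dim ℂ² = 2, and for every subspace M of ℂ² with M ≠ 0 and M ≠ ℂ² one has (1/2)(dim(V_1 ∩ M) + dim(V_2 ∩ M) + dim(V_3 ∩ M) + dim(V_4 ∩ M)) < dim M. -/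
open Module

/-- Two disjoint subspaces meet a subspace `M` in dimensions adding up to at most `dim M`. -/
theorem finrank_inf_add_finrank_inf_le_of_disjoint {K V : Type*} [DivisionRing K] [AddCommGroup V]
    [Module K V] [FiniteDimensional K V] {A B : Submodule K V} (h : Disjoint A B)
    (M : Submodule K V) :
    finrank K ↥(A ⊓ M) + finrank K ↥(B ⊓ M) ≤ finrank K M := by
  have hAB : (A ⊓ M) ⊓ (B ⊓ M) = ⊥ := (h.mono inf_le_left inf_le_left).eq_bot
  have hsum := Submodule.finrank_sup_add_finrank_inf_eq (A ⊓ M) (B ⊓ M)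
  rw [hAB, finrank_bot, add_zero] at hsum
  rw [← hsum]
  exact Submodule.finrank_mono (sup_le inf_le_right inf_le_right)

/-- Vectors of the plane with nonzero determinant span disjoint lines. -/
theorem disjoint_span_singleton_of_det_ne_zero {K : Type*} [Field K] {v w : Fin 2 → K}
    (h : v 0 * w 1 - v 1 * w 0 ≠ 0) :
    Disjoint (Submodule.span K {v}) (Submodule.span K {w}) := by
  rw [Submodule.disjoint_def]
  intro x hv hw
  obtain ⟨a, rfl⟩ := Submodule.mem_span_singleton.1 hv
  obtain ⟨b, hb⟩ := Submodule.mem_span_singleton.1 hw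
  have hb0 : b * w 0 = a * v 0 := congrFun hb 0
  have hb1 : b * w 1 = a * v 1 := congrFun hb 1
  have ha : a * (v 0 * w 1 - v 1 * w 0) = 0 := by linear_combination w 0 * hb1 - w 1 * hb0
  rw [(mul_eq_zero.1 ha).resolve_right h, zero_smul]

/-- **Stability of `𝒱_λ((1,1,1,1))`.**
For `λ ∉ {0, 1}`, the system `⟨e₁⟩, ⟨e₂⟩, ⟨e₁+e₂⟩, ⟨e₁+λe₂⟩` in `ℂ²` is stable
for the weight `(1/2, 1/2, 1/2, 1/2)`. -/
theorem stable_1111 (lam : ℂ) (h0 : lam ≠ 0) (h1 : lam ≠ 1) :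
    ((1 : ℝ) / 2) *
        ((finrank ℂ (Submodule.span ℂ {e 0} : Submodule ℂ (Fin 2 → ℂ)) : ℝ) +
          (finrank ℂ (Submodule.span ℂ {e 1} : Submodule ℂ (Fin 2 → ℂ)) : ℝ) +
          (finrank ℂ (Submodule.span ℂ {e 0 + e 1} : Submodule ℂ (Fin 2 → ℂ)) : ℝ) +
          (finrank ℂ (Submodule.span ℂ {e 0 + lam • e 1} : Submodule ℂ (Fin 2 → ℂ)) : ℝ)) =
        (finrank ℂ (Fin 2 → ℂ) : ℝ) ∧
    finrank ℂ (Fin 2 → ℂ) = 2 ∧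
    ∀ M : Submodule ℂ (Fin 2 → ℂ), M ≠ ⊥ → M ≠ ⊤ →
      ((1 : ℝ) / 2) *
          ((finrank ℂ ↥(Submodule.span ℂ {e 0} ⊓ M) : ℝ) +
            (finrank ℂ ↥(Submodule.span ℂ {e 1} ⊓ M) : ℝ) +
            (finrank ℂ ↥(Submodule.span ℂ {e 0 + e 1} ⊓ M) : ℝ) +
            (finrank ℂ ↥(Submodule.span ℂ {e 0 + lam • e 1} ⊓ M) : ℝ)) <
        (finrank ℂ M : ℝ) := by
  have hdim : finrank ℂ (Fin 2 → ℂ) = 2 := by simp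
  refine ⟨?_, hdim, fun M hbot htop => ?_⟩
  · have h₁ : (e 0 : Fin 2 → ℂ) ≠ 0 := fun h => by simpa [e] using congrFun h 0
    have h₂ : (e 1 : Fin 2 → ℂ) ≠ 0 := fun h => by simpa [e] using congrFun h 1
    have h₃ : (e 0 + e 1 : Fin 2 → ℂ) ≠ 0 := fun h => by simpa [e] using congrFun h 0
    have h₄ : (e 0 + lam • e 1 : Fin 2 → ℂ) ≠ 0 := fun h => by simpa [e] using congrFun h 0
    rw [finrank_span_singleton h₁, finrank_span_singleton h₂, finrank_span_singleton h₃,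
      finrank_span_singleton h₄, hdim]
    norm_num
  · have hpos : 0 < finrank ℂ M := Nat.pos_of_ne_zero (mt Submodule.finrank_eq_zero.1 hbot)
    have hlt : finrank ℂ M < 2 := (Submodule.finrank_lt htop).trans_eq hdim
    have hpair {v w : Fin 2 → ℂ} (h : v 0 * w 1 - v 1 * w 0 ≠ 0) :=
      finrank_inf_add_finrank_inf_le_of_disjoint (disjoint_span_singleton_of_det_ne_zero h) M
    have h₁₂ := hpair (v := e 0) (w := e 1) (by simp [e])
    have h₁₃ := hpair (v := e 0) (w := e 0 + e 1) (by simp [e])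
    have h₁₄ := hpair (v := e 0) (w := e 0 + lam • e 1) (by simpa [e] using h0)
    have h₂₃ := hpair (v := e 1) (w := e 0 + e 1) (by simp [e])
    have h₂₄ := hpair (v := e 1) (w := e 0 + lam • e 1) (by simp [e])
    have h₃₄ := hpair (v := e 0 + e 1) (w := e 0 + lam • e 1)
      (by simpa [e, sub_eq_zero] using h1)
    have hsum : finrank ℂ ↥(Submodule.span ℂ {e 0} ⊓ M) +
        finrank ℂ ↥(Submodule.span ℂ {e 1} ⊓ M) +
        finrank ℂ ↥(Submodule.span ℂ {e 0 + e 1} ⊓ M) +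
        finrank ℂ ↥(Submodule.span ℂ {e 0 + lam • e 1} ⊓ M) < 2 * finrank ℂ M := by
      omega
    rify at hsum
    linarith
end

section
/- Let λ ∈ ℂ with λ ≠ 0 and λ ≠ 1. In ℂ³ with standard basis e_1, e_2, e_3, write e_123 = e_1 + e_2 + e_3, and consider the subspaces V_1 = span{e_123}, V_2 = span{e_123, e_1 + λ e_3}, V_3 = span{e_1}, V_4 = span{e_1, e_2}, V_5 = span{e_3}, V_6 = span{e_2, e_3}. Then this system is stable with respect to the weight assigning 1/3 to each subspace: (1/3) Σ_{i=1}^{6} dim V_i = dim ℂ³ = 3, and for every subspace M of ℂ³ with M ≠ 0 and M ≠ ℂ³ one has (1/3) Σ_{i=1}^{6} dim(V_i ∩ M) < dim M. -/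
open Module

/-- The subspaces of the representation `𝒱_λ((2,2,2))` of the critical poset
`(2,2,2)` in `ℂ³` (with `e₁₂₃ = e₁ + e₂ + e₃`):
`⟨e₁₂₃⟩ ⊆ ⟨e₁₂₃, e₁+λe₃⟩`, `⟨e₁⟩ ⊆ ⟨e₁,e₂⟩`, `⟨e₃⟩ ⊆ ⟨e₂,e₃⟩`. -/
noncomputable def V222 (lam : ℂ) : Fin 6 → Submodule ℂ (Fin 3 → ℂ) :=
  ![Submodule.span ℂ {e 0 + e 1 + e 2},
    Submodule.span ℂ {e 0 + e 1 + e 2, e 0 + lam • e 2},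
    Submodule.span ℂ {e 0},
    Submodule.span ℂ {e 0, e 1},
    Submodule.span ℂ {e 2},
    Submodule.span ℂ {e 1, e 2}]

lemma sum_V222 {A : Type*} [AddCommMonoid A] (lam : ℂ) (f : Submodule ℂ (Fin 3 → ℂ) → A) :
    ∑ i, f (V222 lam i) =
      f (Submodule.span ℂ {e 0 + e 1 + e 2}) +
      f (Submodule.span ℂ {e 0 + e 1 + e 2, e 0 + lam • e 2}) +
      f (Submodule.span ℂ {e 0}) + f (Submodule.span ℂ {e 0, e 1}) +
      f (Submodule.span ℂ {e 2}) + f (Submodule.span ℂ {e 1, e 2}) :=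
  Fin.sum_univ_six _

open Classical in
lemma finrank_span_singleton_inf_le {K E : Type*} [Field K] [AddCommGroup E] [Module K E]
    (v : E) (M : Submodule K E) :
    finrank K ↥(Submodule.span K {v} ⊓ M) ≤ if v ∈ M then 1 else 0 := by
  split_ifs with h
  · exact (Submodule.finrank_mono inf_le_left).trans
      ((finrank_span_le_card ({v} : Set E)).trans (by simp))
  · have : Submodule.span K {v} ⊓ M = ⊥ := by
      rw [Submodule.eq_bot_iff]
      rintro x ⟨hx, hxM⟩
      obtain ⟨c, rfl⟩ := Submodule.mem_span_singleton.1 hx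
      by_contra hc
      exact h ((Submodule.smul_mem_iff M (left_ne_zero_of_smul hc)).1 hxM)
    rw [this, finrank_bot]

open Classical in
lemma finrank_inf_le_of_finrank_eq_two {K E : Type*} [Field K] [AddCommGroup E] [Module K E]
    [FiniteDimensional K E] {W M : Submodule K E} (hW : finrank K W = 2) (hM : finrank K M = 2) :
    finrank K ↥(W ⊓ M) ≤ if W = M then 2 else 1 := by
  split_ifs with h
  · exact (Submodule.finrank_mono inf_le_left).trans hW.le
  · by_contra! h2
    have hl : W ⊓ M = W := Submodule.eq_of_le_of_finrank_le inf_le_left (by omega)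
    have hr : W ⊓ M = M := Submodule.eq_of_le_of_finrank_le inf_le_right (by omega)
    exact h (hl.symm.trans hr)

lemma finrank_span_pair_eq_two {K E : Type*} [Field K] [AddCommGroup E] [Module K E] {u v : E}
    (h : ∀ s t : K, s • u + t • v = 0 → s = 0 ∧ t = 0) :
    finrank K (Submodule.span K {u, v}) = 2 := by
  have := finrank_span_eq_card (LinearIndependent.pair_iff.2 h)
  rwa [Matrix.range_cons_cons_empty, Fintype.card_fin] at this

lemma mem_span_diagonal_pair {lam : ℂ} {v : Fin 3 → ℂ} :
    v ∈ Submodule.span ℂ {e 0 + e 1 + e 2, e 0 + lam • e 2} ↔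
      lam * v 0 + (1 - lam) * v 1 = v 2 := by
  rw [Submodule.mem_span_pair]
  constructor
  · rintro ⟨a, b, rfl⟩
    simp [e]
    ring
  · intro h
    refine ⟨v 1, v 0 - v 1, funext fun i => ?_⟩
    fin_cases i <;> simp [e]
    linear_combination h

lemma mem_span_e_zero_e_one {v : Fin 3 → ℂ} :
    v ∈ Submodule.span ℂ {e 0, e 1} ↔ v 2 = 0 := by
  rw [Submodule.mem_span_pair]
  constructor
  · rintro ⟨a, b, rfl⟩
    simp [e]
  · intro h
    refine ⟨v 0, v 1, funext fun i => ?_⟩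
    fin_cases i <;> simp [e, h]

lemma mem_span_e_one_e_two {v : Fin 3 → ℂ} :
    v ∈ Submodule.span ℂ {e 1, e 2} ↔ v 0 = 0 := by
  rw [Submodule.mem_span_pair]
  constructor
  · rintro ⟨a, b, rfl⟩
    simp [e]
  · intro h
    refine ⟨v 1, v 2, funext fun i => ?_⟩
    fin_cases i <;> simp [e, h]

lemma apply_eq_of_mem_span_diagonal {v : Fin 3 → ℂ}
    (h : v ∈ Submodule.span ℂ {e 0 + e 1 + e 2}) : v 0 = v 1 ∧ v 1 = v 2 := by
  obtain ⟨a, rfl⟩ := Submodule.mem_span_singleton.1 h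
  simp [e]

lemma apply_eq_zero_of_mem_span_e {i j : Fin 3} (hij : j ≠ i) {v : Fin 3 → ℂ}
    (h : v ∈ Submodule.span ℂ {e i}) : v j = 0 := by
  obtain ⟨a, rfl⟩ := Submodule.mem_span_singleton.1 h
  simp [e, hij]

lemma finrank_span_diagonal_pair (lam : ℂ) :
    finrank ℂ (Submodule.span ℂ {e 0 + e 1 + e 2, (e 0 + lam • e 2 : Fin 3 → ℂ)}) = 2 := by
  refine finrank_span_pair_eq_two fun s t h => ?_
  have h0 := congrFun h 0
  have h1 := congrFun h 1
  simp [e] at h0 h1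
  simp_all

lemma finrank_span_e_pair {i j : Fin 3} (hij : i ≠ j) :
    finrank ℂ (Submodule.span ℂ {(e i : Fin 3 → ℂ), e j}) = 2 := by
  refine finrank_span_pair_eq_two fun s t h => ?_
  have hi := congrFun h i
  have hj := congrFun h j
  simp [e, hij, hij.symm] at hi hj
  exact ⟨hi, hj⟩

lemma diagonal_ne_zero : (e 0 + e 1 + e 2 : Fin 3 → ℂ) ≠ 0 := fun h => by
  simpa [e] using congrFun h 0

lemma e_ne_zero {n : ℕ} (i : Fin n) : e i ≠ 0 := by simp [e]

lemma eq_top_of_diagonal_mem {M : Submodule ℂ (Fin 3 → ℂ)} (h : e 0 + e 1 + e 2 ∈ M)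
    (h0 : e 0 ∈ M) (h2 : e 2 ∈ M) : M = ⊤ := by
  refine Submodule.eq_top_iff'.2 fun v => ?_
  have hv : v = v 1 • (e 0 + e 1 + e 2) + (v 0 - v 1) • e 0 + (v 2 - v 1) • e 2 := by
    funext i
    fin_cases i <;> simp [e]
  rw [hv]
  exact M.add_mem (M.add_mem (M.smul_mem _ h) (M.smul_mem _ h0)) (M.smul_mem _ h2)

lemma sum_finrank_inf_lt_of_finrank_eq_one {lam : ℂ} (h0 : lam ≠ 0) (h1 : lam ≠ 1)
    {M : Submodule ℂ (Fin 3 → ℂ)} (hM : finrank ℂ M = 1) :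
    ∑ i, finrank ℂ ↥(V222 lam i ⊓ M) < 3 := by
  classical
  obtain ⟨v, hv, rfl⟩ : ∃ v : Fin 3 → ℂ, v ≠ 0 ∧ M = Submodule.span ℂ {v} := by
    obtain ⟨⟨v, hvM⟩, hv, -⟩ := finrank_eq_one_iff'.1 hM
    have hv0 : v ≠ 0 := fun h => hv (Subtype.ext h)
    refine ⟨v, hv0, (Submodule.eq_of_le_of_finrank_eq ?_ ?_).symm⟩
    · simpa using hvM
    · rw [finrank_span_singleton hv0, hM]
  have hle (W : Submodule ℂ (Fin 3 → ℂ)) :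
      finrank ℂ ↥(W ⊓ Submodule.span ℂ {v}) ≤ if v ∈ W then 1 else 0 := by
    rw [inf_comm]
    exact finrank_span_singleton_inf_le v W
  refine (Finset.sum_le_sum fun i _ => hle (V222 lam i)).trans_lt ?_
  rw [sum_V222 lam fun W => if v ∈ W then 1 else 0]
  have hne : ¬(v 0 = 0 ∧ v 1 = 0 ∧ v 2 = 0) := fun ⟨a, b, c⟩ => hv <| by
    funext i
    fin_cases i <;> assumption
  have h1' : 1 - lam ≠ 0 := sub_ne_zero.2 h1.symm
  have hd := @apply_eq_of_mem_span_diagonal v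
  have ha := @apply_eq_zero_of_mem_span_e 0 1 (by decide) v
  have ha' := @apply_eq_zero_of_mem_span_e 0 2 (by decide) v
  have hc := @apply_eq_zero_of_mem_span_e 2 0 (by decide) v
  have hc' := @apply_eq_zero_of_mem_span_e 2 1 (by decide) v
  simp only [mem_span_diagonal_pair, mem_span_e_zero_e_one, mem_span_e_one_e_two]
  split_ifs <;> first | omega | (exfalso; clear hle hM hv; grind)

lemma sum_finrank_inf_lt_of_finrank_eq_two {lam : ℂ} (h0 : lam ≠ 0)
    {M : Submodule ℂ (Fin 3 → ℂ)} (hM : finrank ℂ M = 2) :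
    ∑ i, finrank ℂ ↥(V222 lam i ⊓ M) < 6 := by
  classical
  have hline (v : Fin 3 → ℂ) := finrank_span_singleton_inf_le v M
  have hd := hline (e 0 + e 1 + e 2)
  have ha := hline (e 0)
  have hc := hline (e 2)
  have hp := finrank_inf_le_of_finrank_eq_two (finrank_span_diagonal_pair lam) hM
  have hq := finrank_inf_le_of_finrank_eq_two (finrank_span_e_pair (i := 0) (j := 1) (by decide)) hM
  have hr := finrank_inf_le_of_finrank_eq_two (finrank_span_e_pair (i := 1) (j := 2) (by decide)) hM
  have htop : ¬(e 0 + e 1 + e 2 ∈ M ∧ e 0 ∈ M ∧ e 2 ∈ M) := fun ⟨h, h', h''⟩ => by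
    rw [eq_top_of_diagonal_mem h h' h''] at hM
    simp at hM
  have hmem {W : Submodule ℂ (Fin 3 → ℂ)} (h : W = M) (v) : v ∈ M ↔ v ∈ W := by rw [h]
  rw [sum_V222 lam fun W => finrank ℂ ↥(W ⊓ M)]
  refine (add_le_add (add_le_add (add_le_add (add_le_add (add_le_add hd hp) ha) hq) hc)
    hr).trans_lt ?_
  by_cases hP : Submodule.span ℂ {e 0 + e 1 + e 2, e 0 + lam • e 2} = M
  · have hPa : e 0 ∉ M := by rw [hmem hP, mem_span_diagonal_pair]; simp [e, h0]
    have hPc : e 2 ∉ M := by rw [hmem hP, mem_span_diagonal_pair]; simp [e]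
    have hPq : Submodule.span ℂ {e 0, e 1} ≠ M := fun h =>
      hPa (by rw [hmem h, mem_span_e_zero_e_one]; simp [e])
    have hPr : Submodule.span ℂ {e 1, e 2} ≠ M := fun h =>
      hPc (by rw [hmem h, mem_span_e_one_e_two]; simp [e])
    split_ifs <;> omega
  by_cases hQ : Submodule.span ℂ {e 0, e 1} = M
  · have hQd : e 0 + e 1 + e 2 ∉ M := by rw [hmem hQ, mem_span_e_zero_e_one]; simp [e]
    have hQc : e 2 ∉ M := by rw [hmem hQ, mem_span_e_zero_e_one]; simp [e]
    have hQr : Submodule.span ℂ {e 1, e 2} ≠ M := fun h =>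
      hQc (by rw [hmem h, mem_span_e_one_e_two]; simp [e])
    split_ifs <;> first | omega | contradiction
  by_cases hR : Submodule.span ℂ {e 1, e 2} = M
  · have hRd : e 0 + e 1 + e 2 ∉ M := by rw [hmem hR, mem_span_e_one_e_two]; simp [e]
    have hRa : e 0 ∉ M := by rw [hmem hR, mem_span_e_one_e_two]; simp [e]
    split_ifs <;> first | omega | contradiction
  split_ifs <;> first | omega | simp_all

/-- **Stability of `𝒱_λ((2,2,2))`** for the weight assigning `1/3` to each of
the six subspaces, for any `λ ∉ {0, 1}`. -/
theorem stable_222 (lam : ℂ) (h0 : lam ≠ 0) (h1 : lam ≠ 1) :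
    (∑ i : Fin 6, ((1 : ℝ) / 3) * (finrank ℂ (V222 lam i) : ℝ)) =
        (finrank ℂ (Fin 3 → ℂ) : ℝ) ∧
    finrank ℂ (Fin 3 → ℂ) = 3 ∧
    ∀ M : Submodule ℂ (Fin 3 → ℂ), M ≠ ⊥ → M ≠ ⊤ →
      (∑ i : Fin 6, ((1 : ℝ) / 3) * (finrank ℂ ↥(V222 lam i ⊓ M) : ℝ)) <
        (finrank ℂ M : ℝ) := by
  refine ⟨?_, by simp, fun M hbot htop => ?_⟩
  · rw [sum_V222 lam fun W => (1 : ℝ) / 3 * finrank ℂ W, finrank_span_diagonal_pair,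
      finrank_span_e_pair (by decide), finrank_span_e_pair (by decide),
      finrank_span_singleton diagonal_ne_zero, finrank_span_singleton (e_ne_zero _),
      finrank_span_singleton (e_ne_zero _)]
    norm_num
  · have hpos : finrank ℂ M ≠ 0 := fun h => hbot (Submodule.finrank_eq_zero.1 h)
    have hlt : finrank ℂ M < 3 := by simpa using Submodule.finrank_lt (lt_top_iff_ne_top.2 htop).ne
    have key : ∑ i, finrank ℂ ↥(V222 lam i ⊓ M) < 3 * finrank ℂ M := by
      obtain h | h : finrank ℂ M = 1 ∨ finrank ℂ M = 2 := by omega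
      · simpa [h] using sum_finrank_inf_lt_of_finrank_eq_one h0 h1 h
      · simpa [h] using sum_finrank_inf_lt_of_finrank_eq_two h0 h
    have key' : ∑ i, (finrank ℂ ↥(V222 lam i ⊓ M) : ℝ) < 3 * finrank ℂ M := by
      exact_mod_cast key
    rw [← Finset.mul_sum]
    linarith
end

section
/- Let λ ∈ ℂ with λ ≠ 0 and λ ≠ 1. In ℂ⁶ with standard basis e_1,...,e_6, write e_123 = e_1 + e_2 + e_3, e_245 = e_2 + e_4 + e_5, e_16 = e_1 + e_6, and consider the subspaces V_1 = span{e_123, e_245, e_16}, V_2 = span{e_5, e_6}, V_3 = span{e_1, e_2, e_5, e_6}, V_4 = span{e_4}, V_5 = span{e_3, e_4}, V_6 = span{e_2, e_3, e_4}, V_7 = span{e_1, e_2, e_3, e_4}, V_8 = span{e_1, e_2, e_3, e_4, e_5 + λ e_6}, with weights χ_1 = 3/6, χ_2 = χ_3 = 2/6, and χ_i = 1/6 for i = 4,...,8. Then this system is χ-stable: Σ_{i=1}^{8} χ_i dim V_i = dim ℂ⁶ = 6, and for every subspace M of ℂ⁶ with M ≠ 0 and M ≠ ℂ⁶ one has Σ_{i=1}^{8}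 χ_i dim(V_i ∩ M) < dim M. -/
open Module

/-- The subspaces of the representation `𝒱_λ((1,2,5))` of the critical poset
`(1,2,5)` in `ℂ⁶` (with `e₁₂₃ = e₁+e₂+e₃`, `e₂₄₅ = e₂+e₄+e₅`, `e₁₆ = e₁+e₆`). -/
noncomputable def V125 (lam : ℂ) : Fin 8 → Submodule ℂ (Fin 6 → ℂ) :=
  ![Submodule.span ℂ {e 0 + e 1 + e 2, e 1 + e 3 + e 4, e 0 + e 5},
    Submodule.span ℂ {e 4, e 5},
    Submodule.span ℂ {e 0, e 1, e 4, e 5},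
    Submodule.span ℂ {e 3},
    Submodule.span ℂ {e 2, e 3},
    Submodule.span ℂ {e 1, e 2, e 3},
    Submodule.span ℂ {e 0, e 1, e 2, e 3},
    Submodule.span ℂ {e 0, e 1, e 2, e 3, e 4 + lam • e 5}]

/-- The weight `(3/6, 2/6, 2/6, 1/6, 1/6, 1/6, 1/6, 1/6)` for `𝒱_λ((1,2,5))`. -/
noncomputable def chi125 : Fin 8 → ℝ :=
  ![3 / 6, 2 / 6, 2 / 6, 1 / 6, 1 / 6, 1 / 6, 1 / 6, 1 / 6]

section Rank

variable {K E : Type*} [DivisionRing K] [AddCommGroup E] [Module K E] [FiniteDimensional K E]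

lemma finrank_add_le_add_finrank_inf {A B M : Submodule K E} (hA : A ≤ M) (hB : B ≤ M) :
    finrank K A + finrank K B ≤ finrank K M + finrank K ↥(A ⊓ B) := by
  have h := Submodule.finrank_sup_add_finrank_inf_eq A B
  have h' := Submodule.finrank_mono (sup_le hA hB)
  omega

lemma finrank_sup_eq_of_inf_eq_bot {A B : Submodule K E} (h : A ⊓ B = ⊥) :
    finrank K ↥(A ⊔ B) = finrank K A + finrank K B := by
  have h' := Submodule.finrank_sup_add_finrank_inf_eq A B
  rwa [h, finrank_bot, add_zero] at h'

lemma finrank_add_le_of_inf_eq_bot {A B M : Submodule K E} (hA : A ≤ M) (hB : B ≤ M)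
    (h : A ⊓ B = ⊥) : finrank K A + finrank K B ≤ finrank K M := by
  rw [← finrank_sup_eq_of_inf_eq_bot h]
  exact Submodule.finrank_mono (sup_le hA hB)

lemma finrank_add_add_le_of_inf_eq_bot {A B C M : Submodule K E} (hA : A ≤ M) (hB : B ≤ M)
    (hC : C ≤ M) (hAB : A ⊓ B = ⊥) (h : (A ⊔ B) ⊓ C = ⊥) :
    finrank K A + finrank K B + finrank K C ≤ finrank K M := by
  rw [← finrank_sup_eq_of_inf_eq_bot hAB]
  exact finrank_add_le_of_inf_eq_bot (sup_le hA hB) hC h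

end Rank

section Membership

variable {lam : ℂ} {x : Fin 6 → ℂ}

lemma mem_V125_zero (h : x ∈ V125 lam 0) :
    x 0 = x 2 + x 5 ∧ x 1 = x 2 + x 3 ∧ x 4 = x 3 := by
  simp only [V125, Matrix.cons_val, Submodule.mem_span_insert, Submodule.mem_span_singleton] at h
  obtain ⟨a, _, ⟨b, _, ⟨c, rfl⟩, rfl⟩, rfl⟩ := h
  simp [e]

lemma mem_V125_one (h : x ∈ V125 lam 1) : x 0 = 0 ∧ x 1 = 0 ∧ x 2 = 0 ∧ x 3 = 0 := by
  simp only [V125, Matrix.cons_val, Submodule.mem_span_insert, Submodule.mem_span_singleton] at h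
  obtain ⟨a, _, ⟨b, rfl⟩, rfl⟩ := h
  simp [e]

lemma mem_V125_two (h : x ∈ V125 lam 2) : x 2 = 0 ∧ x 3 = 0 := by
  simp only [V125, Matrix.cons_val, Submodule.mem_span_insert, Submodule.mem_span_singleton] at h
  obtain ⟨a, _, ⟨b, _, ⟨c, _, ⟨d, rfl⟩, rfl⟩, rfl⟩, rfl⟩ := h
  simp [e]

lemma mem_V125_three (h : x ∈ V125 lam 3) :
    x 0 = 0 ∧ x 1 = 0 ∧ x 2 = 0 ∧ x 4 = 0 ∧ x 5 = 0 := by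
  simp only [V125, Matrix.cons_val, Submodule.mem_span_singleton] at h
  obtain ⟨a, rfl⟩ := h
  simp [e]

lemma mem_V125_four (h : x ∈ V125 lam 4) : x 0 = 0 ∧ x 1 = 0 ∧ x 4 = 0 ∧ x 5 = 0 := by
  simp only [V125, Matrix.cons_val, Submodule.mem_span_insert, Submodule.mem_span_singleton] at h
  obtain ⟨a, _, ⟨b, rfl⟩, rfl⟩ := h
  simp [e]

lemma mem_V125_five (h : x ∈ V125 lam 5) : x 0 = 0 ∧ x 4 = 0 ∧ x 5 = 0 := by
  simp only [V125, Matrix.cons_val, Submodule.mem_span_insert, Submodule.mem_span_singleton] at h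
  obtain ⟨a, _, ⟨b, _, ⟨c, rfl⟩, rfl⟩, rfl⟩ := h
  simp [e]

lemma mem_V125_six (h : x ∈ V125 lam 6) : x 4 = 0 ∧ x 5 = 0 := by
  simp only [V125, Matrix.cons_val, Submodule.mem_span_insert, Submodule.mem_span_singleton] at h
  obtain ⟨a, _, ⟨b, _, ⟨c, _, ⟨d, rfl⟩, rfl⟩, rfl⟩, rfl⟩ := h
  simp [e]

lemma mem_V125_seven (h : x ∈ V125 lam 7) : x 5 = lam * x 4 := by
  simp only [V125, Matrix.cons_val, Submodule.mem_span_insert, Submodule.mem_span_singleton] at h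
  obtain ⟨a, _, ⟨b, _, ⟨c, _, ⟨d, _, ⟨f, rfl⟩, rfl⟩, rfl⟩, rfl⟩, rfl⟩ := h
  simp [e, mul_comm]

end Membership

lemma eq_zero_of_apply_eq_zero {x : Fin 6 → ℂ}
    (h : x 0 = 0 ∧ x 1 = 0 ∧ x 2 = 0 ∧ x 3 = 0 ∧ x 4 = 0 ∧ x 5 = 0) : x = 0 := by
  ext i
  fin_cases i <;> simp [h]

lemma linearIndependent_of_apply {n : ℕ} {v : Fin n → Fin 6 → ℂ}
    (h : ∀ g : Fin n → ℂ, (∀ j, ∑ i, g i * v i j = 0) → ∀ i, g i = 0) :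
    LinearIndependent ℂ v :=
  Fintype.linearIndependent_iff.mpr fun g hg ↦ h g fun j ↦ by simpa using congrFun hg j

lemma finrank_V125 (lam : ℂ) (i : Fin 8) :
    finrank ℂ (V125 lam i) = ![3, 2, 4, 1, 2, 3, 4, 5] i := by
  have key : ∀ {n : ℕ} (v : Fin n → Fin 6 → ℂ), LinearIndependent ℂ v →
      ∀ s : Set (Fin 6 → ℂ), Set.range v = s → finrank ℂ (Submodule.span ℂ s) = n := by
    rintro n v hv _ rfl
    simpa using finrank_span_eq_card hv
  fin_cases i
  · exact key ![e 0 + e 1 + e 2, e 1 + e 3 + e 4, e 0 + e 5]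
      (linearIndependent_of_apply (by simp [Fin.sum_univ_succ, Fin.forall_fin_succ, e])) _
      (by simp only [Matrix.range_cons, Matrix.range_empty, Set.union_empty, Set.singleton_union])
  · exact key ![e 4, e 5]
      (linearIndependent_of_apply (by simp [Fin.sum_univ_succ, Fin.forall_fin_succ, e])) _
      (by simp only [Matrix.range_cons, Matrix.range_empty, Set.union_empty, Set.singleton_union])
  · exact key ![e 0, e 1, e 4, e 5]
      (linearIndependent_of_apply (by simp [Fin.sum_univ_succ, Fin.forall_fin_succ, e])) _
      (by simp only [Matrix.range_cons, Matrix.range_empty, Set.union_empty, Set.singleton_union])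
  · exact key ![e 3]
      (linearIndependent_of_apply (by simp [Fin.forall_fin_succ, e])) _
      (by simp only [Matrix.range_cons, Matrix.range_empty, Set.union_empty])
  · exact key ![e 2, e 3]
      (linearIndependent_of_apply (by simp [Fin.sum_univ_succ, Fin.forall_fin_succ, e])) _
      (by simp only [Matrix.range_cons, Matrix.range_empty, Set.union_empty, Set.singleton_union])
  · exact key ![e 1, e 2, e 3]
      (linearIndependent_of_apply (by simp [Fin.sum_univ_succ, Fin.forall_fin_succ, e])) _
      (by simp only [Matrix.range_cons, Matrix.range_empty, Set.union_empty, Set.singleton_union])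
  · exact key ![e 0, e 1, e 2, e 3]
      (linearIndependent_of_apply (by simp [Fin.sum_univ_succ, Fin.forall_fin_succ, e])) _
      (by simp only [Matrix.range_cons, Matrix.range_empty, Set.union_empty, Set.singleton_union])
  · exact key ![e 0, e 1, e 2, e 3, e 4 + lam • e 5]
      (linearIndependent_of_apply (by simp [Fin.sum_univ_succ, Fin.forall_fin_succ, e]; grind)) _
      (by simp only [Matrix.range_cons, Matrix.range_empty, Set.union_empty, Set.singleton_union])

/-- The inequalities are indexed by the regular simple representations in the exceptional tubes of
ranks five, three and two of the extended Dynkin quiver `Ẽ₈`; each of them has no nonzero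
morphism to `𝒱_λ((1,2,5))`. -/
lemma finrank_V125_inf_le {lam : ℂ} (h0 : lam ≠ 0) (h1 : lam ≠ 1)
    (M : Submodule ℂ (Fin 6 → ℂ)) {r : Fin 8 → ℕ}
    (hr : ∀ i, r i = finrank ℂ ↥(V125 lam i ⊓ M)) :
    (r 0 + r 2 + r 7 ≤ 2 * finrank ℂ M ∧ r 0 + r 5 ≤ finrank ℂ M ∧ r 1 + r 6 ≤ finrank ℂ M ∧
      r 2 + r 4 ≤ finrank ℂ M ∧ r 0 + r 1 + r 3 ≤ finrank ℂ M) ∧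
    (r 0 + r 1 + r 4 + r 7 ≤ 2 * finrank ℂ M ∧ r 0 + r 2 + r 3 + r 6 ≤ 2 * finrank ℂ M ∧
      r 0 + r 1 + r 2 + r 5 ≤ 2 * finrank ℂ M) ∧
    (r 0 + r 1 + r 2 + r 3 + r 5 + r 7 ≤ 3 * finrank ℂ M ∧
      2 * r 0 + r 1 + r 2 + r 4 + r 6 ≤ 3 * finrank ℂ M) := by
  obtain ⟨A, hA⟩ : ∃ A : Fin 8 → Submodule ℂ (Fin 6 → ℂ), ∀ i, A i = V125 lam i ⊓ M :=
    ⟨_, fun _ ↦ rfl⟩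
  have hAM : ∀ i, A i ≤ M := fun i ↦ hA i ▸ inf_le_right
  have hAV : ∀ {i x}, x ∈ A i → x ∈ V125 lam i := fun {i x} hx ↦ by
    rw [hA] at hx; exact hx.1
  replace hr : ∀ i, r i = finrank ℂ (A i) := fun i ↦ by rw [hr, hA]
  have m0 : ∀ x ∈ A 0, _ := fun x hx ↦ mem_V125_zero (hAV hx)
  have m1 : ∀ x ∈ A 1, _ := fun x hx ↦ mem_V125_one (hAV hx)
  have m2 : ∀ x ∈ A 2, _ := fun x hx ↦ mem_V125_two (hAV hx)
  have m3 : ∀ x ∈ A 3, _ := fun x hx ↦ mem_V125_three (hAV hx)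
  have m4 : ∀ x ∈ A 4, _ := fun x hx ↦ mem_V125_four (hAV hx)
  have m5 : ∀ x ∈ A 5, _ := fun x hx ↦ mem_V125_five (hAV hx)
  have m6 : ∀ x ∈ A 6, _ := fun x hx ↦ mem_V125_six (hAV hx)
  have m7 : ∀ x ∈ A 7, _ := fun x hx ↦ mem_V125_seven (hAV hx)
  have hinf : ∀ i j, A i ⊓ A j ≤ M := fun i j ↦ inf_le_left.trans (hAM i)
  have hcod : ∀ i j, r i + r j ≤ finrank ℂ M + finrank ℂ ↥(A i ⊓ A j) := fun i j ↦ by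
    rw [hr, hr]; exact finrank_add_le_add_finrank_inf (hAM i) (hAM j)
  refine ⟨⟨?_, ?_, ?_, ?_, ?_⟩, ⟨?_, ?_, ?_⟩, ?_, ?_⟩
  · have h := finrank_add_le_of_inf_eq_bot (hinf 0 2) (hAM 7) (by
      refine (Submodule.eq_bot_iff _).mpr ?_
      rintro x ⟨⟨h0x, h2x⟩, h7x⟩
      have := m0 x h0x
      have := m2 x h2x
      have := m7 x h7x
      exact eq_zero_of_apply_eq_zero (by grind))
    have := hcod 0 2
    simp only [hr] at *
    omega
  · have h := finrank_add_le_of_inf_eq_bot (hAM 0) (hAM 5) (by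
      refine (Submodule.eq_bot_iff _).mpr ?_
      rintro x ⟨h0x, h5x⟩
      have := m0 x h0x
      have := m5 x h5x
      exact eq_zero_of_apply_eq_zero (by grind))
    simp only [hr] at *
    omega
  · have h := finrank_add_le_of_inf_eq_bot (hAM 1) (hAM 6) (by
      refine (Submodule.eq_bot_iff _).mpr ?_
      rintro x ⟨h1x, h6x⟩
      have := m1 x h1x
      have := m6 x h6x
      exact eq_zero_of_apply_eq_zero (by grind))
    simp only [hr] at *
    omega
  · have h := finrank_add_le_of_inf_eq_bot (hAM 2) (hAM 4) (by
      refine (Submodule.eq_bot_iff _).mpr ?_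
      rintro x ⟨h2x, h4x⟩
      have := m2 x h2x
      have := m4 x h4x
      exact eq_zero_of_apply_eq_zero (by grind))
    simp only [hr] at *
    omega
  · have h := finrank_add_add_le_of_inf_eq_bot (hAM 0) (hAM 1) (hAM 3) (by
      refine (Submodule.eq_bot_iff _).mpr ?_
      rintro x ⟨h0x, h1x⟩
      have := m0 x h0x
      have := m1 x h1x
      exact eq_zero_of_apply_eq_zero (by grind)) (by
      refine (Submodule.eq_bot_iff _).mpr ?_
      rintro x ⟨hx, h3x⟩
      obtain ⟨y, h0y, z, h1z, rfl⟩ := Submodule.mem_sup.mp hx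
      have := m0 y h0y
      have := m1 z h1z
      have := m3 (y + z) h3x
      simp only [Pi.add_apply] at *
      exact eq_zero_of_apply_eq_zero (by simp only [Pi.add_apply]; grind))
    simp only [hr] at *
    omega
  · have h := finrank_add_add_le_of_inf_eq_bot (hAM 4) (hinf 0 7) (hAM 1) (by
      refine (Submodule.eq_bot_iff _).mpr ?_
      rintro x ⟨h4x, ⟨h0x, h7x⟩⟩
      have := m4 x h4x
      have := m0 x h0x
      have := m7 x h7x
      exact eq_zero_of_apply_eq_zero (by grind)) (by
      refine (Submodule.eq_bot_iff _).mpr ?_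
      rintro x ⟨hx, h1x⟩
      obtain ⟨y, h4y, z, ⟨h0z, h7z⟩, rfl⟩ := Submodule.mem_sup.mp hx
      have := m4 y h4y
      have := m0 z h0z
      have := m7 z h7z
      have := m1 (y + z) h1x
      simp only [Pi.add_apply] at *
      exact eq_zero_of_apply_eq_zero (by simp only [Pi.add_apply]; grind))
    have := hcod 0 7
    simp only [hr] at *
    omega
  · have h := finrank_add_add_le_of_inf_eq_bot (hAM 3) (hinf 0 6) (hAM 2) (by
      refine (Submodule.eq_bot_iff _).mpr ?_
      rintro x ⟨h3x, ⟨h0x, h6x⟩⟩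
      have := m3 x h3x
      have := m0 x h0x
      have := m6 x h6x
      exact eq_zero_of_apply_eq_zero (by grind)) (by
      refine (Submodule.eq_bot_iff _).mpr ?_
      rintro x ⟨hx, h2x⟩
      obtain ⟨y, h3y, z, ⟨h0z, h6z⟩, rfl⟩ := Submodule.mem_sup.mp hx
      have := m3 y h3y
      have := m0 z h0z
      have := m6 z h6z
      have := m2 (y + z) h2x
      simp only [Pi.add_apply] at *
      exact eq_zero_of_apply_eq_zero (by simp only [Pi.add_apply]; grind))
    have := hcod 0 6
    simp only [hr] at *
    omega
  · have h := finrank_add_add_le_of_inf_eq_bot (hAM 1) (hinf 0 2) (hAM 5) (by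
      refine (Submodule.eq_bot_iff _).mpr ?_
      rintro x ⟨h1x, ⟨h0x, h2x⟩⟩
      have := m1 x h1x
      have := m0 x h0x
      have := m2 x h2x
      exact eq_zero_of_apply_eq_zero (by grind)) (by
      refine (Submodule.eq_bot_iff _).mpr ?_
      rintro x ⟨hx, h5x⟩
      obtain ⟨y, h1y, z, ⟨h0z, h2z⟩, rfl⟩ := Submodule.mem_sup.mp hx
      have := m1 y h1y
      have := m0 z h0z
      have := m2 z h2z
      have := m5 (y + z) h5x
      simp only [Pi.add_apply] at *
      exact eq_zero_of_apply_eq_zero (by simp only [Pi.add_apply]; grind))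
    have := hcod 0 2
    simp only [hr] at *
    omega
  · have h35 : A 3 ⊓ (A 2 ⊓ A 5) = ⊥ := by
      refine (Submodule.eq_bot_iff _).mpr ?_
      rintro x ⟨h3x, ⟨h2x, h5x⟩⟩
      have := m3 x h3x
      have := m2 x h2x
      have := m5 x h5x
      exact eq_zero_of_apply_eq_zero (by grind)
    have h17 : (A 3 ⊔ (A 2 ⊓ A 5)) ⊓ (A 1 ⊓ A 7) = ⊥ := by
      refine (Submodule.eq_bot_iff _).mpr ?_
      rintro x ⟨hx, ⟨h1x, h7x⟩⟩
      obtain ⟨y, h3y, z, ⟨h2z, h5z⟩, rfl⟩ := Submodule.mem_sup.mp hx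
      have := m3 y h3y
      have := m2 z h2z
      have := m5 z h5z
      have := m1 (y + z) h1x
      have := m7 (y + z) h7x
      simp only [Pi.add_apply] at *
      exact eq_zero_of_apply_eq_zero (by simp only [Pi.add_apply]; grind)
    have h := finrank_add_add_le_of_inf_eq_bot (sup_le (hAM 3) (hinf 2 5)) (hinf 1 7)
      (hAM 0) h17 (by
      refine (Submodule.eq_bot_iff _).mpr ?_
      rintro x ⟨hx, h0x⟩
      obtain ⟨w, hw, u, ⟨h1u, h7u⟩, rfl⟩ := Submodule.mem_sup.mp hx
      obtain ⟨y, h3y, z, ⟨h2z, h5z⟩, rfl⟩ := Submodule.mem_sup.mp hw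
      have := m3 y h3y
      have := m2 z h2z
      have := m5 z h5z
      have := m1 u h1u
      have := m7 u h7u
      have := m0 _ h0x
      simp only [Pi.add_apply] at *
      exact eq_zero_of_apply_eq_zero (by simp only [Pi.add_apply]; grind))
    rw [finrank_sup_eq_of_inf_eq_bot h35] at h
    have := hcod 2 5
    have := hcod 1 7
    simp only [hr] at *
    omega
  · have h04 : A 0 ⊓ A 4 = ⊥ := by
      refine (Submodule.eq_bot_iff _).mpr ?_
      rintro x ⟨h0x, h4x⟩
      have := m0 x h0x
      have := m4 x h4x
      exact eq_zero_of_apply_eq_zero (by grind)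
    have h01 : A 0 ⊓ A 1 = ⊥ := by
      refine (Submodule.eq_bot_iff _).mpr ?_
      rintro x ⟨h0x, h1x⟩
      have := m0 x h0x
      have := m1 x h1x
      exact eq_zero_of_apply_eq_zero (by grind)
    have hP := sup_le (hAM 0) (hAM 4)
    have h := finrank_add_le_of_inf_eq_bot (inf_le_of_left_le hP) (sup_le (hAM 0) (hAM 1))
      (show ((A 0 ⊔ A 4) ⊓ (A 2 ⊓ A 6)) ⊓ (A 0 ⊔ A 1) = ⊥ by
      refine (Submodule.eq_bot_iff _).mpr ?_
      rintro x ⟨⟨hx, h2x, h6x⟩, hx'⟩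
      have := m2 x h2x
      have := m6 x h6x
      obtain ⟨y, h0y, z, h4z, rfl⟩ := Submodule.mem_sup.mp hx
      obtain ⟨u, h0u, v, h1v, huv⟩ := Submodule.mem_sup.mp hx'
      have := m0 y h0y
      have := m4 z h4z
      have := m0 u h0u
      have := m1 v h1v
      have huv := fun i ↦ congrFun huv i
      simp only [Pi.add_apply] at *
      have := huv 0
      have := huv 1
      have := huv 2
      have := huv 3
      have := huv 4
      have := huv 5
      clear huv
      exact eq_zero_of_apply_eq_zero (by simp only [Pi.add_apply]; grind))
    have h' := finrank_add_le_add_finrank_inf hP (hinf 2 6)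
    rw [finrank_sup_eq_of_inf_eq_bot h01] at h
    rw [finrank_sup_eq_of_inf_eq_bot h04] at h'
    have := hcod 2 6
    simp only [hr] at *
    omega

/-- **Stability of `𝒱_λ((1,2,5))`** for the weight
`χ = (3/6, 2/6, 2/6, 1/6, 1/6, 1/6, 1/6, 1/6)`, for any `λ ∉ {0, 1}`. -/
theorem stable_125 (lam : ℂ) (h0 : lam ≠ 0) (h1 : lam ≠ 1) :
    (∑ i : Fin 8, chi125 i * (finrank ℂ (V125 lam i) : ℝ)) =
        (finrank ℂ (Fin 6 → ℂ) : ℝ) ∧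
    finrank ℂ (Fin 6 → ℂ) = 6 ∧
    ∀ M : Submodule ℂ (Fin 6 → ℂ), M ≠ ⊥ → M ≠ ⊤ →
      (∑ i : Fin 8, chi125 i * (finrank ℂ ↥(V125 lam i ⊓ M) : ℝ)) <
        (finrank ℂ M : ℝ) := by
  refine ⟨?_, by simp, fun M hbot htop ↦ ?_⟩
  · simp only [finrank_V125, finrank_fin_fun]
    simp [Fin.sum_univ_succ, chi125]
    norm_num
  · obtain ⟨r, hr⟩ : ∃ r : Fin 8 → ℕ, ∀ i, r i = finrank ℂ ↥(V125 lam i ⊓ M) :=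
      ⟨_, fun _ ↦ rfl⟩
    have hineq := finrank_V125_inf_le h0 h1 M hr
    have hpos : 0 < finrank ℂ M :=
      Nat.pos_of_ne_zero fun h ↦ hbot (Submodule.finrank_eq_zero.mp h)
    have hlt : finrank ℂ M < 6 := by
      simpa using Submodule.finrank_lt htop
    simp only [← hr]
    have h : 3 * r 0 + 2 * r 1 + 2 * r 2 + r 3 + r 4 + r 5 + r 6 + r 7 < 6 * finrank ℂ M := by
      omega
    have h' : (3 * r 0 + 2 * r 1 + 2 * r 2 + r 3 + r 4 + r 5 + r 6 + r 7 : ℝ) <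
        6 * finrank ℂ M := by exact_mod_cast h
    simp only [Fin.sum_univ_eight, chi125, Matrix.cons_val]
    linarith
end

section
/- Let λ ∈ ℂ with λ ≠ 0 and λ ≠ 1. In ℂ⁵ with standard basis e_1,...,e_5, write e_235 = e_2 + e_3 + e_5 and e_134 = e_1 + e_3 + e_4, and consider the subspaces V_1 = span{e_235, e_134}, V_2 = span{e_5}, V_3 = span{e_235, e_134, e_5, e_3 + λ e_4}, V_4 = span{e_1, e_2, e_5}, V_5 = span{e_4}, V_6 = span{e_3, e_4}, V_7 = span{e_2, e_3, e_4}, V_8 = span{e_1, e_2, e_3, e_4}, with weights χ_1 = 2/5, χ_2 = 1/5, χ_3 = 1/5, χ_4 = 2/5, and χ_i = 1/5 for i = 5,...,8. Then this system is χ-stable: Σ_{i=1}^{8} χ_i dim V_i = dim ℂ⁵ = 5, and for every subspace M of ℂ⁵ with M ≠ 0 and M ≠ ℂ⁵ one has Σ_{i=1}^{8} χ_i dim(V_i ∩ M) < dim M. -/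
open Module

/-- The subspaces of the representation `𝒱_λ((N,4))` of the critical poset
`(N,4)` in `ℂ⁵` (with `e₂₃₅ = e₂+e₃+e₅`, `e₁₃₄ = e₁+e₃+e₄`). -/
noncomputable def VN4 (lam : ℂ) : Fin 8 → Submodule ℂ (Fin 5 → ℂ) :=
  ![Submodule.span ℂ {e 1 + e 2 + e 4, e 0 + e 2 + e 3},
    Submodule.span ℂ {e 4},
    Submodule.span ℂ {e 1 + e 2 + e 4, e 0 + e 2 + e 3, e 4, e 2 + lam • e 3},
    Submodule.span ℂ {e 0, e 1, e 4},
    Submodule.span ℂ {e 3},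
    Submodule.span ℂ {e 2, e 3},
    Submodule.span ℂ {e 1, e 2, e 3},
    Submodule.span ℂ {e 0, e 1, e 2, e 3}]

/-- The weight `(2/5, 1/5, 1/5, 2/5, 1/5, 1/5, 1/5, 1/5)` for `𝒱_λ((N,4))`. -/
noncomputable def chiN4 : Fin 8 → ℝ :=
  ![2 / 5, 1 / 5, 1 / 5, 2 / 5, 1 / 5, 1 / 5, 1 / 5, 1 / 5]

section Compl

variable {K V : Type*} [DivisionRing K] [AddCommGroup V] [Module K V] [FiniteDimensional K V]

/-- The traces of two disjoint subspaces on `M` have total dimension at most `dim M`. -/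
lemma finrank_inf_add_finrank_inf_le {A B : Submodule K V} (h : Disjoint A B)
    (M : Submodule K V) :
    finrank K ↥(A ⊓ M) + finrank K ↥(B ⊓ M) ≤ finrank K M := by
  have h' : (A ⊓ M) ⊓ (B ⊓ M) = ⊥ := (h.mono inf_le_left inf_le_left).eq_bot
  have key := Submodule.finrank_sup_add_finrank_inf_eq (A ⊓ M) (B ⊓ M)
  rw [h', finrank_bot, add_zero] at key
  rw [← key]
  exact Submodule.finrank_mono (sup_le inf_le_right inf_le_right)

/-- If the traces of `A` and `B` on `M` fill `M`, then `M` is stable under the projection onto `A`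
along `B`. -/
lemma left_mem_of_finrank_le {A B M : Submodule K V} (h : Disjoint A B)
    (hM : finrank K M ≤ finrank K ↥(A ⊓ M) + finrank K ↥(B ⊓ M))
    {a b : V} (ha : a ∈ A) (hb : b ∈ B) (hab : a + b ∈ M) : a ∈ M := by
  have h' : (A ⊓ M) ⊓ (B ⊓ M) = ⊥ := (h.mono inf_le_left inf_le_left).eq_bot
  have key := Submodule.finrank_sup_add_finrank_inf_eq (A ⊓ M) (B ⊓ M)
  rw [h', finrank_bot, add_zero] at key
  have hsup : (A ⊓ M) ⊔ (B ⊓ M) = M :=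
    Submodule.eq_of_le_of_finrank_le (sup_le inf_le_right inf_le_right) (hM.trans key.ge)
  rw [← hsup] at hab
  obtain ⟨a', ⟨ha', haM⟩, b', ⟨hb', -⟩, hab'⟩ := Submodule.mem_sup.1 hab
  have hd : a - a' = b' - b := by
    rw [sub_eq_sub_iff_add_eq_add, ← hab', add_comm b']
  have h0 : a - a' = 0 :=
    Submodule.disjoint_def.1 h _ (A.sub_mem ha ha') (hd ▸ B.sub_mem hb' hb)
  rwa [sub_eq_zero.1 h0]

end Compl

lemma mem_VN4_zero (lam : ℂ) (x : Fin 5 → ℂ) :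
    x ∈ VN4 lam 0 ↔ x 2 = x 0 + x 1 ∧ x 3 = x 0 ∧ x 4 = x 1 := by
  simp only [VN4, e, Matrix.cons_val, Submodule.mem_span_pair]
  constructor
  · rintro ⟨a, b, rfl⟩
    simp [add_comm]
  · rintro ⟨h2, h3, h4⟩
    refine ⟨x 1, x 0, ?_⟩
    ext i
    fin_cases i <;> simp [h2, h3, h4, add_comm]

lemma mem_VN4_one (lam : ℂ) (x : Fin 5 → ℂ) :
    x ∈ VN4 lam 1 ↔ x 0 = 0 ∧ x 1 = 0 ∧ x 2 = 0 ∧ x 3 = 0 := by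
  simp only [VN4, e, Matrix.cons_val, Submodule.mem_span_singleton]
  constructor
  · rintro ⟨a, rfl⟩
    simp
  · rintro ⟨h0, h1, h2, h3⟩
    refine ⟨x 4, ?_⟩
    ext i
    fin_cases i <;> simp [h0, h1, h2, h3]

lemma mem_VN4_two (lam : ℂ) (x : Fin 5 → ℂ) :
    x ∈ VN4 lam 2 ↔ x 3 = (1 - lam) * x 0 - lam * x 1 + lam * x 2 := by
  simp only [VN4, e, Matrix.cons_val, Submodule.mem_span_insert, Submodule.mem_span_singleton]
  constructor
  · rintro ⟨a, _, ⟨b, _, ⟨c, _, ⟨d, rfl⟩, rfl⟩, rfl⟩, rfl⟩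
    simp
    ring
  · intro h
    refine ⟨x 1, _, ⟨x 0, _, ⟨x 4 - x 1, _, ⟨x 2 - x 0 - x 1, rfl⟩, rfl⟩, rfl⟩, ?_⟩
    ext i
    fin_cases i <;> simp [h] <;> ring

lemma mem_VN4_three (lam : ℂ) (x : Fin 5 → ℂ) :
    x ∈ VN4 lam 3 ↔ x 2 = 0 ∧ x 3 = 0 := by
  simp only [VN4, e, Matrix.cons_val, Submodule.mem_span_insert, Submodule.mem_span_singleton]
  constructor
  · rintro ⟨a, _, ⟨b, _, ⟨c, rfl⟩, rfl⟩, rfl⟩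
    simp
  · rintro ⟨h2, h3⟩
    refine ⟨x 0, _, ⟨x 1, _, ⟨x 4, rfl⟩, rfl⟩, ?_⟩
    ext i
    fin_cases i <;> simp [h2, h3]

lemma mem_VN4_four (lam : ℂ) (x : Fin 5 → ℂ) :
    x ∈ VN4 lam 4 ↔ x 0 = 0 ∧ x 1 = 0 ∧ x 2 = 0 ∧ x 4 = 0 := by
  simp only [VN4, e, Matrix.cons_val, Submodule.mem_span_singleton]
  constructor
  · rintro ⟨a, rfl⟩
    simp
  · rintro ⟨h0, h1, h2, h4⟩
    refine ⟨x 3, ?_⟩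
    ext i
    fin_cases i <;> simp [h0, h1, h2, h4]

lemma mem_VN4_five (lam : ℂ) (x : Fin 5 → ℂ) :
    x ∈ VN4 lam 5 ↔ x 0 = 0 ∧ x 1 = 0 ∧ x 4 = 0 := by
  simp only [VN4, e, Matrix.cons_val, Submodule.mem_span_pair]
  constructor
  · rintro ⟨a, b, rfl⟩
    simp
  · rintro ⟨h0, h1, h4⟩
    refine ⟨x 2, x 3, ?_⟩
    ext i
    fin_cases i <;> simp [h0, h1, h4]

lemma mem_VN4_six (lam : ℂ) (x : Fin 5 → ℂ) :
    x ∈ VN4 lam 6 ↔ x 0 = 0 ∧ x 4 = 0 := by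
  simp only [VN4, e, Matrix.cons_val, Submodule.mem_span_insert, Submodule.mem_span_singleton]
  constructor
  · rintro ⟨a, _, ⟨b, _, ⟨c, rfl⟩, rfl⟩, rfl⟩
    simp
  · rintro ⟨h0, h4⟩
    refine ⟨x 1, _, ⟨x 2, _, ⟨x 3, rfl⟩, rfl⟩, ?_⟩
    ext i
    fin_cases i <;> simp [h0, h4]

lemma mem_VN4_seven (lam : ℂ) (x : Fin 5 → ℂ) :
    x ∈ VN4 lam 7 ↔ x 4 = 0 := by
  simp only [VN4, e, Matrix.cons_val, Submodule.mem_span_insert, Submodule.mem_span_singleton]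
  constructor
  · rintro ⟨a, _, ⟨b, _, ⟨c, _, ⟨d, rfl⟩, rfl⟩, rfl⟩, rfl⟩
    simp
  · intro h4
    refine ⟨x 0, _, ⟨x 1, _, ⟨x 2, _, ⟨x 3, rfl⟩, rfl⟩, rfl⟩, ?_⟩
    ext i
    fin_cases i <;> simp [h4]

lemma isCompl_of_forall_mem {K V : Type*} [DivisionRing K] [AddCommGroup V] [Module K V]
    {A B : Submodule K V} (h : ∀ x ∈ A, x ∈ B → x = 0) (p : V → V)
    (hp : ∀ x, p x ∈ A ∧ x - p x ∈ B) : IsCompl A B := by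
  refine ⟨Submodule.disjoint_def.2 h, codisjoint_iff.2 (eq_top_iff.2 fun x _ => ?_)⟩
  exact Submodule.mem_sup.2 ⟨p x, (hp x).1, x - p x, (hp x).2, by abel⟩

lemma isCompl_VN4_zero_three (lam : ℂ) : IsCompl (VN4 lam 0) (VN4 lam 3) := by
  refine isCompl_of_forall_mem (fun x hx hy => ?_)
    (fun x => ![x 3, x 2 - x 3, x 2, x 3, x 2 - x 3]) fun x => ?_
  · rw [mem_VN4_zero] at hx
    rw [mem_VN4_three] at hy
    ext i
    fin_cases i <;> simp <;> grind
  · simp [-Matrix.sub_cons, mem_VN4_zero, mem_VN4_three]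

lemma isCompl_VN4_zero_six (lam : ℂ) : IsCompl (VN4 lam 0) (VN4 lam 6) := by
  refine isCompl_of_forall_mem (fun x hx hy => ?_)
    (fun x => ![x 0, x 4, x 0 + x 4, x 0, x 4]) fun x => ?_
  · rw [mem_VN4_zero] at hx
    rw [mem_VN4_six] at hy
    ext i
    fin_cases i <;> simp <;> grind
  · simp [-Matrix.sub_cons, mem_VN4_zero, mem_VN4_six]

lemma isCompl_VN4_three_five (lam : ℂ) : IsCompl (VN4 lam 3) (VN4 lam 5) := by
  refine isCompl_of_forall_mem (fun x hx hy => ?_)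
    (fun x => ![x 0, x 1, 0, 0, x 4]) fun x => ?_
  · rw [mem_VN4_three] at hx
    rw [mem_VN4_five] at hy
    ext i
    fin_cases i <;> simp <;> grind
  · simp [-Matrix.sub_cons, mem_VN4_three, mem_VN4_five]

lemma isCompl_VN4_one_seven (lam : ℂ) : IsCompl (VN4 lam 1) (VN4 lam 7) := by
  refine isCompl_of_forall_mem (fun x hx hy => ?_)
    (fun x => ![0, 0, 0, 0, x 4]) fun x => ?_
  · rw [mem_VN4_one] at hx
    rw [mem_VN4_seven] at hy
    ext i
    fin_cases i <;> simp <;> grind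
  · simp [-Matrix.sub_cons, mem_VN4_one, mem_VN4_seven]

lemma isCompl_VN4_four_two (lam : ℂ) : IsCompl (VN4 lam 4) (VN4 lam 2) := by
  refine isCompl_of_forall_mem (fun x hx hy => ?_)
    (fun x => ![0, 0, 0, x 3 - ((1 - lam) * x 0 - lam * x 1 + lam * x 2), 0]) fun x => ?_
  · rw [mem_VN4_four] at hx
    rw [mem_VN4_two] at hy
    ext i
    fin_cases i <;> simp <;> grind
  · simp [-Matrix.sub_cons, mem_VN4_four, mem_VN4_two]

/-- A nonzero subspace stable under the projections attached to the five complementary pairs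
is everything. -/
lemma eq_top_of_stable_projections {lam : ℂ} (h0 : lam ≠ 0) (h1 : lam ≠ 1)
    {M : Submodule ℂ (Fin 5 → ℂ)} (hM : M ≠ ⊥)
    (p03 : ∀ x ∈ M, ![x 3, x 2 - x 3, x 2, x 3, x 2 - x 3] ∈ M)
    (p06 : ∀ x ∈ M, ![x 0, x 4, x 0 + x 4, x 0, x 4] ∈ M)
    (p35 : ∀ x ∈ M, ![x 0, x 1, 0, 0, x 4] ∈ M)
    (p17 : ∀ x ∈ M, ![0, 0, 0, 0, x 4] ∈ M)
    (p42 : ∀ x ∈ M, ![0, 0, 0, x 3 - ((1 - lam) * x 0 - lam * x 1 + lam * x 2), 0] ∈ M) :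
    M = ⊤ := by
  have top_of_e4 : (![0, 0, 0, 0, 1] : Fin 5 → ℂ) ∈ M → M = ⊤ := by
    intro e4
    have e235 : (![0, 1, 1, 0, 1] : Fin 5 → ℂ) ∈ M := by simpa using p06 _ e4
    have e14 : (![0, 1, 0, 0, 1] : Fin 5 → ℂ) ∈ M := by simpa using p35 _ e235
    have e1 : (![0, 1, 0, 0, 0] : Fin 5 → ℂ) ∈ M := by
      convert M.sub_mem e14 e4 using 1
      simp
    have e2 : (![0, 0, 1, 0, 0] : Fin 5 → ℂ) ∈ M := by
      convert M.sub_mem e235 e14 using 1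
      simp
    have e3 : (![0, 0, 0, 1, 0] : Fin 5 → ℂ) ∈ M := by
      simpa [h0] using M.smul_mem (-lam⁻¹) (p42 _ e2)
    have w : (![1, -1, 0, 1, -1] : Fin 5 → ℂ) ∈ M := by simpa using p03 _ e3
    have e0 : (![1, 0, 0, 0, 0] : Fin 5 → ℂ) ∈ M := by
      convert M.sub_mem (M.add_mem (M.add_mem w e1) e4) e3 using 1
      simp
    refine eq_top_iff.2 fun x _ => ?_
    have hx := M.add_mem (M.add_mem (M.add_mem (M.add_mem (M.smul_mem (x 0) e0)
      (M.smul_mem (x 1) e1)) (M.smul_mem (x 2) e2)) (M.smul_mem (x 3) e3)) (M.smul_mem (x 4) e4)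
    convert hx using 1
    ext i
    fin_cases i <;> simp
  by_contra hne
  have h4 : ∀ x ∈ M, x 4 = 0 := by
    intro x hx
    by_contra hc
    exact hne (top_of_e4 (by simpa [hc] using M.smul_mem (x 4)⁻¹ (p17 x hx)))
  have hf : ∀ x ∈ M, x 3 = (1 - lam) * x 0 - lam * x 1 + lam * x 2 := by
    intro x hx
    have ha := h4 _ (p03 _ (p42 x hx))
    simp at ha
    linear_combination -ha
  have h23 : ∀ x ∈ M, x 2 = 0 ∧ x 3 = 0 := by
    intro x hx
    have ha : x 2 - x 3 = 0 := by simpa using h4 _ (p03 x hx)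
    have hb := hf _ (M.sub_mem hx (p35 x hx))
    simp at hb
    have hc : (lam - 1) * x 2 = 0 := by linear_combination -ha - hb
    have hd := (mul_eq_zero.1 hc).resolve_left (sub_ne_zero.2 h1)
    exact ⟨hd, by simpa [hd] using ha⟩
  refine hM ((Submodule.eq_bot_iff M).2 fun x hx => ?_)
  obtain ⟨h2, h3⟩ := h23 x hx
  have hx4 := h4 x hx
  have hx0 : x 0 = 0 := by simpa using (h23 _ (p06 x hx)).2
  have hx1 : x 1 = 0 := by simpa [h2, h3, hx0, h0] using hf x hx
  ext i
  fin_cases i <;> simp [hx0, hx1, h2, h3, hx4]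

/-- **Stability of `𝒱_λ((N,4))`** for the weight
`χ = (2/5, 1/5, 1/5, 2/5, 1/5, 1/5, 1/5, 1/5)`, for any `λ ∉ {0, 1}`. -/
theorem stable_N4 (lam : ℂ) (h0 : lam ≠ 0) (h1 : lam ≠ 1) :
    (∑ i : Fin 8, chiN4 i * (finrank ℂ (VN4 lam i) : ℝ)) =
        (finrank ℂ (Fin 5 → ℂ) : ℝ) ∧
    finrank ℂ (Fin 5 → ℂ) = 5 ∧
    ∀ M : Submodule ℂ (Fin 5 → ℂ), M ≠ ⊥ → M ≠ ⊤ →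
      (∑ i : Fin 8, chiN4 i * (finrank ℂ ↥(VN4 lam i ⊓ M) : ℝ)) <
        (finrank ℂ M : ℝ) := by
  have c03 := isCompl_VN4_zero_three lam
  have c06 := isCompl_VN4_zero_six lam
  have c35 := isCompl_VN4_three_five lam
  have c17 := isCompl_VN4_one_seven lam
  have c42 := isCompl_VN4_four_two lam
  have h5 : finrank ℂ (Fin 5 → ℂ) = 5 := by simp
  refine ⟨?_, h5, fun M hbot htop => ?_⟩
  · have d03 := Submodule.finrank_add_eq_of_isCompl c03
    have d06 := Submodule.finrank_add_eq_of_isCompl c06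
    have d35 := Submodule.finrank_add_eq_of_isCompl c35
    have d17 := Submodule.finrank_add_eq_of_isCompl c17
    have d42 := Submodule.finrank_add_eq_of_isCompl c42
    rify at d03 d06 d35 d17 d42
    simp only [Fin.sum_univ_eight, chiN4, Matrix.cons_val]
    linarith
  · have d03 := finrank_inf_add_finrank_inf_le c03.disjoint M
    have d06 := finrank_inf_add_finrank_inf_le c06.disjoint M
    have d35 := finrank_inf_add_finrank_inf_le c35.disjoint M
    have d17 := finrank_inf_add_finrank_inf_le c17.disjoint M
    have d42 := finrank_inf_add_finrank_inf_le c42.disjoint M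
    by_contra hlt
    have hge : 5 * finrank ℂ M ≤ 2 * finrank ℂ ↥(VN4 lam 0 ⊓ M) + finrank ℂ ↥(VN4 lam 1 ⊓ M)
        + finrank ℂ ↥(VN4 lam 2 ⊓ M) + 2 * finrank ℂ ↥(VN4 lam 3 ⊓ M)
        + finrank ℂ ↥(VN4 lam 4 ⊓ M) + finrank ℂ ↥(VN4 lam 5 ⊓ M)
        + finrank ℂ ↥(VN4 lam 6 ⊓ M) + finrank ℂ ↥(VN4 lam 7 ⊓ M) := by
      simp only [Fin.sum_univ_eight, chiN4, Matrix.cons_val, not_lt] at hlt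
      rify
      linarith
    refine htop (eq_top_of_stable_projections h0 h1 hbot (fun x hx => ?_) (fun x hx => ?_)
      (fun x hx => ?_) (fun x hx => ?_) (fun x hx => ?_))
    · refine left_mem_of_finrank_le c03.disjoint (by omega) ?_ ?_
        ((add_sub_cancel _ x).symm ▸ hx) <;> simp [-Matrix.sub_cons, mem_VN4_zero, mem_VN4_three]
    · refine left_mem_of_finrank_le c06.disjoint (by omega) ?_ ?_
        ((add_sub_cancel _ x).symm ▸ hx) <;> simp [-Matrix.sub_cons, mem_VN4_zero, mem_VN4_six]
    · refine left_mem_of_finrank_le c35.disjoint (by omega) ?_ ?_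
        ((add_sub_cancel _ x).symm ▸ hx) <;> simp [-Matrix.sub_cons, mem_VN4_three, mem_VN4_five]
    · refine left_mem_of_finrank_le c17.disjoint (by omega) ?_ ?_
        ((add_sub_cancel _ x).symm ▸ hx) <;> simp [-Matrix.sub_cons, mem_VN4_one, mem_VN4_seven]
    · refine left_mem_of_finrank_le c42.disjoint (by omega) ?_ ?_
        ((add_sub_cancel _ x).symm ▸ hx) <;> simp [-Matrix.sub_cons, mem_VN4_four, mem_VN4_two]
end
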